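/- Every exponential-polynomial instance of order at most 6 with 2 sequences is MSTV-reducible. (This is the paper's theorem that SimSkolem(6,2) is MSTV-reducible, hence decidable, and equivalently that the reduced Subspace Orbit Problem with inherent dimension 6 and target dimension 4 is decidable.) -/

import Mathlib

open scoped Classical

noncomputable section

/-- `ℚ̄`, a fixed algebraic closure of `ℚ`. -/
abbrev Qbar : Type := AlgebraicClosure ℚ

/-- An absolute value is non-Archimedean if it satisfies the ultrametric inequality. -/
def IsNonarch {L : Type*} [Field L] (v : AbsoluteValue L ℝ) : Prop :=
  ∀ x y : L, v (x + y) ≤ max (v x) (v y)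

/-- An absolute value is nontrivial if it takes a value `≠ 1` at some nonzero element. -/
def AbsNontrivial {L : Type*} [Field L] (v : AbsoluteValue L ℝ) : Prop :=
  ∃ x : L, x ≠ 0 ∧ v x ≠ 1

/-- An exponential-polynomial instance of order at most `d` with `k` sequences: distinct
nonzero roots `lam i` in `ℚ̄` whose ratios are not roots of unity, multiplicities `m i ≥ 1`
with `∑ m i ≤ d`, and `k` linearly independent coefficient vectors indexed by
`T = {(i, j) : j < m i}`. -/
structure ExpPolyInstance (d k : ℕ) where
  s : ℕ
  lam : Fin s → Qbar
  m : Fin s → ℕ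
  coeff : Fin k → ((i : Fin s) × Fin (m i)) → Qbar
  lam_ne_zero : ∀ i, lam i ≠ 0
  lam_injective : Function.Injective lam
  nondeg : ∀ i j, i ≠ j → ∀ n : ℕ, 1 ≤ n → (lam i / lam j) ^ n ≠ 1
  m_pos : ∀ i, 1 ≤ m i
  order_le : (∑ i, m i) ≤ d
  indep : LinearIndependent Qbar coeff

/-- A nonzero vector `w : T → ℚ̄` lies in the MSTV class (relative to the roots `lam`) if
there are a number field `L ⊆ ℚ̄` containing the roots and a nontrivial absolute value `v` on
`L` such that among the indices `i` with some `w (i, j) ≠ 0`, the number of `v`-dominant ones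
is at most `2` when `v` is non-Archimedean and at most `3` when `v` is Archimedean. -/
def InMSTV {s : ℕ} {m : Fin s → ℕ} (lam : Fin s → Qbar)
    (w : ((i : Fin s) × Fin (m i)) → Qbar) : Prop :=
  w ≠ 0 ∧
  ∃ (L : IntermediateField ℚ Qbar) (hmem : ∀ i, lam i ∈ L),
    FiniteDimensional ℚ L ∧
    ∃ v : AbsoluteValue L ℝ, AbsNontrivial v ∧
      (IsNonarch v →
        (Finset.univ.filter (fun i : Fin s =>
          (∃ j, w ⟨i, j⟩ ≠ 0) ∧
          ∀ i' : Fin s, (∃ j', w ⟨i', j'⟩ ≠ 0) →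
            v ⟨lam i', hmem i'⟩ ≤ v ⟨lam i, hmem i⟩)).card ≤ 2) ∧
      (¬ IsNonarch v →
        (Finset.univ.filter (fun i : Fin s =>
          (∃ j, w ⟨i, j⟩ ≠ 0) ∧
          ∀ i' : Fin s, (∃ j', w ⟨i', j'⟩ ≠ 0) →
            v ⟨lam i', hmem i'⟩ ≤ v ⟨lam i, hmem i⟩)).card ≤ 3)

/-- An instance is MSTV-reducible if some nonzero linear combination of its coefficient
vectors lies in the MSTV class. -/
def MSTVReducible {d k : ℕ} (I : ExpPolyInstance d k) : Prop :=
  ∃ β : Fin k → Qbar, β ≠ 0 ∧ InMSTV I.lam (∑ p, β p • I.coeff p)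

/-- The indices in `S` at which the absolute value `v` of the family `x` is maximal. -/
def dominant {ι L : Type*} [Field L] (v : AbsoluteValue L ℝ) (x : ι → L) (S : Finset ι) :
    Finset ι :=
  S.filter fun i => ∀ j ∈ S, v (x j) ≤ v (x i)

section Dominant

variable {ι L : Type*} [Field L]

lemma mem_dominant {v : AbsoluteValue L ℝ} {x : ι → L} {S : Finset ι} {i : ι} :
    i ∈ dominant v x S ↔ i ∈ S ∧ ∀ j ∈ S, v (x j) ≤ v (x i) := by
  simp [dominant]

lemma dominant_subset (v : AbsoluteValue L ℝ) (x : ι → L) (S : Finset ι) :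
    dominant v x S ⊆ S :=
  Finset.filter_subset _ _

lemma dominant_nonempty (v : AbsoluteValue L ℝ) (x : ι → L) {S : Finset ι} (hS : S.Nonempty) :
    (dominant v x S).Nonempty := by
  obtain ⟨i, hi, h⟩ := S.exists_max_image (fun i => v (x i)) hS
  exact ⟨i, mem_dominant.2 ⟨hi, h⟩⟩

lemma dominant_erase_subset [DecidableEq ι] {v : AbsoluteValue L ℝ} {x : ι → L}
    {S : Finset ι} {d i : ι}
    (hd : d ∈ dominant v x S) (hdi : d ≠ i) :
    dominant v x (S.erase i) ⊆ (dominant v x S).erase i := by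
  intro j hj
  rw [mem_dominant, Finset.mem_erase] at hj
  rw [mem_dominant] at hd
  refine Finset.mem_erase.2 ⟨hj.1.1, mem_dominant.2 ⟨hj.1.2, fun l hl => ?_⟩⟩
  exact (hd.2 l hl).trans (hj.2 d (Finset.mem_erase.2 ⟨hdi, hd.1⟩))

/-- Some index can be removed so that the number of dominant indices drops, unless there is
only one. -/
lemma exists_card_dominant_erase_le [DecidableEq ι] (v : AbsoluteValue L ℝ) (x : ι → L)
    {S : Finset ι}
    (hS : 1 < S.card) :
    ∃ i ∈ S, (dominant v x (S.erase i)).card ≤ max 1 ((dominant v x S).card - 1) := by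
  obtain ⟨d, hd⟩ := dominant_nonempty v x (Finset.card_pos.1 (zero_lt_one.trans hS))
  by_cases h : ∃ i ∈ dominant v x S, i ≠ d
  · obtain ⟨i, hi, hid⟩ := h
    refine ⟨i, dominant_subset _ _ _ hi, le_max_of_le_right ?_⟩
    exact (Finset.card_le_card (dominant_erase_subset hd hid.symm)).trans
      (Finset.card_erase_of_mem hi).le
  · push Not at h
    obtain ⟨i, hi, hid⟩ := Finset.exists_mem_ne hS d
    refine ⟨i, hi, le_max_of_le_left ?_⟩
    refine (Finset.card_le_card ((dominant_erase_subset hd hid.symm).trans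
      (Finset.erase_subset _ _))).trans ?_
    exact Finset.card_le_one.2 fun a ha b hb => (h a ha).trans (h b hb).symm

/-- If `w` reverses the order that `v` induces on the values `x i`, `i ∈ A`, and `v` is not
constant there, then no index of `A` is dominant for both `v` and `w`. -/
lemma card_dominant_add_card_dominant_le {v w : AbsoluteValue L ℝ} {x : ι → L}
    {S A : Finset ι} (hx : ∀ i, x i ≠ 0) (hAS : A ⊆ S)
    (hrev : ∀ i ∈ A, ∀ j ∈ A, w (x i) * v (x i) = w (x j) * v (x j))
    (hne : ∃ i ∈ A, ∃ j ∈ A, v (x i) ≠ v (x j)) :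
    (dominant w x S).card + (dominant v x S).card ≤ (S \ A).card + S.card := by
  have hsub : dominant w x S ⊆ (S \ A) ∪ (S \ dominant v x S) := by
    intro i hi
    have hiS := dominant_subset _ _ _ hi
    rw [Finset.mem_union, Finset.mem_sdiff, Finset.mem_sdiff]
    by_contra! hcon
    have hiA := hcon.1 hiS
    have hiv := (mem_dominant.1 (hcon.2 hiS)).2
    have hiw := (mem_dominant.1 hi).2
    have hconst : ∀ j ∈ A, v (x j) = v (x i) := by
      intro j hj
      refine le_antisymm (hiv j (hAS hj)) (not_lt.1 fun hlt => ?_)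
      have h1 := hiw j (hAS hj)
      have h2 := hrev i hiA j hj
      have h3 := w.pos (hx i)
      have h4 := v.pos (hx j)
      nlinarith
    obtain ⟨a, ha, b, hb, hab⟩ := hne
    exact hab ((hconst a ha).trans (hconst b hb).symm)
  have h1 := (Finset.card_le_card hsub).trans (Finset.card_union_le _ _)
  have h2 := Finset.card_sdiff_add_card_eq_card (dominant_subset v x S)
  omega

end Dominant

section Place

variable {L : Type*} [Field L]

lemma absNontrivial_place (φ : L →+* ℂ) [CharZero L] :
    AbsNontrivial (NumberField.place φ) :=
  ⟨2, two_ne_zero, by simp [NumberField.place_apply, map_ofNat φ 2]⟩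

lemma not_isNonarch_place (φ : L →+* ℂ) : ¬ IsNonarch (NumberField.place φ) := by
  intro h
  have := h 1 1
  rw [one_add_one_eq_two] at this
  norm_num [NumberField.place_apply, map_ofNat φ 2] at this

/-- **Kronecker's theorem**: an element of a number field all of whose absolute values are `1`
is a root of unity. -/
lemma exists_absoluteValue_ne_one [NumberField L] {u : L}
    (hu : ∀ n : ℕ, 1 ≤ n → u ^ n ≠ 1) : ∃ v : AbsoluteValue L ℝ, v u ≠ 1 := by
  by_contra! hcon
  have hint : u ∈ (algebraMap (NumberField.RingOfIntegers L) L).range := by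
    refine IsDedekindDomain.HeightOneSpectrum.mem_integers_of_valuation_le_one L u fun v => ?_
    have h := hcon (NumberField.HeightOneSpectrum.adicAbv L v)
    rw [NumberField.HeightOneSpectrum.adicAbv_def] at h
    have h' := NNReal.coe_eq_one.1 h
    exact ((WithZeroMulInt.toNNReal_strictMono
      (NumberField.HeightOneSpectrum.one_lt_absNorm_nnreal v)).injective
        (h'.trans (map_one _).symm)).le
  obtain ⟨y, rfl⟩ := hint
  obtain ⟨n, hn, h⟩ := NumberField.Embeddings.pow_eq_one_of_norm_eq_one L ℂ
    (NumberField.RingOfIntegers.isIntegral_coe y)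
    fun φ => hcon (NumberField.place φ)
  exact hu n hn h

/-- On a Galois number field, complex conjugation is induced by an automorphism. -/
lemma exists_algEquiv_conj [NumberField L] [IsGalois ℚ L] (φ : L →+* ℂ) :
    ∃ c : L ≃ₐ[ℚ] L, ∀ a, φ (c a) = starRingEnd ℂ (φ a) := by
  obtain ⟨σ, hσ⟩ := NumberField.ComplexEmbedding.exists_comp_symm_eq_of_comp_eq (k := ℚ) φ
    ((starRingEnd ℂ).comp φ) (Subsingleton.elim _ _)
  exact ⟨σ.symm, fun a => RingHom.congr_fun hσ a⟩

/-- For elements of a Galois number field whose ratios are not roots of unity, either some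
absolute value has at most `k` dominant indices, or some Archimedean one leaves out more than `r`
indices. -/
theorem exists_absoluteValue_card_dominant_le [NumberField L] [IsGalois ℚ L] {ι : Type*}
    {x : ι → L} (hx : ∀ i, x i ≠ 0)
    (hnd : ∀ i j, i ≠ j → ∀ n : ℕ, 1 ≤ n → (x i / x j) ^ n ≠ 1)
    {S : Finset ι} {k r : ℕ} (hS : S.card + r ≤ 2 * k + 1) (hr : r + 1 ≤ k) :
    ∃ v : AbsoluteValue L ℝ, AbsNontrivial v ∧
      ((dominant v x S).card ≤ k ∨ (¬ IsNonarch v ∧ (dominant v x S).card + r + 1 ≤ S.card)) := by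
  obtain ⟨φ⟩ : Nonempty (L →+* ℂ) := inferInstance
  have hφ := absNontrivial_place φ
  set A := dominant (NumberField.place φ) x S with hA
  by_cases hsmall : A.card ≤ k ∨ A.card + r + 1 ≤ S.card
  · exact ⟨_, hφ, hsmall.imp_right fun h => ⟨not_isNonarch_place φ, h⟩⟩
  push Not at hsmall
  obtain ⟨i, hi, j, hj, hij⟩ := Finset.one_lt_card.1 (show 1 < A.card by omega)
  obtain ⟨v, hv⟩ := exists_absoluteValue_ne_one (hnd i j hij)
  by_cases hvk : (dominant v x S).card ≤ k
  · exact ⟨v, ⟨_, div_ne_zero (hx i) (hx j), hv⟩, Or.inl hvk⟩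
  have hvij : v (x i) ≠ v (x j) := by
    intro h
    rw [map_div₀, h, div_self (v.ne_zero (hx j))] at hv
    exact hv rfl
  obtain ⟨c, hc⟩ := exists_algEquiv_conj φ
  have hcx : ∀ a ∈ A, ∀ b ∈ A, c (x a) * x a = c (x b) * x b := by
    intro a ha b hb
    rw [hA, mem_dominant] at ha hb
    have hab : ‖φ (x a)‖ = ‖φ (x b)‖ := le_antisymm (hb.2 a ha.1) (ha.2 b hb.1)
    apply φ.injective
    rw [map_mul, map_mul, hc, hc, Complex.conj_mul', Complex.conj_mul', hab]
  have hinj : Function.Injective (c : L →+* L) := c.injective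
  have hcard := card_dominant_add_card_dominant_le (w := v.comp hinj) hx
    (dominant_subset (NumberField.place φ) x S)
    (fun a ha b hb => by
      have := congrArg v (hcx a ha b hb)
      rwa [map_mul, map_mul] at this)
    ⟨i, hi, j, hj, hvij⟩
  have hsd := Finset.card_sdiff_add_card_eq_card (dominant_subset (NumberField.place φ) x S)
  refine ⟨v.comp hinj, ⟨c.symm (x i / x j), ?_, ?_⟩, Or.inl ?_⟩
  · simpa using ⟨hx i, hx j⟩
  · change v (c (c.symm (x i / x j))) ≠ 1
    rwa [AlgEquiv.apply_symm_apply]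
  · rw [← hA] at hsd hcard
    omega

end Place

section Reduction

/-- The indices of the roots that occur in `w`. -/
def rootSupport {s : ℕ} {m : Fin s → ℕ} (w : ((i : Fin s) × Fin (m i)) → Qbar) :
    Finset (Fin s) :=
  Finset.univ.filter fun i => ∃ j, w ⟨i, j⟩ ≠ 0

lemma inMSTV_of_card_dominant_le {s : ℕ} {m : Fin s → ℕ} {lam : Fin s → Qbar}
    {w : ((i : Fin s) × Fin (m i)) → Qbar} (hw : w ≠ 0) {L : IntermediateField ℚ Qbar}
    [hL : FiniteDimensional ℚ L] (hmem : ∀ i, lam i ∈ L) {v : AbsoluteValue L ℝ}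
    (hv : AbsNontrivial v)
    (h : (dominant v (fun i => (⟨lam i, hmem i⟩ : L)) (rootSupport w)).card ≤ 2 ∨
      (¬ IsNonarch v ∧
        (dominant v (fun i => (⟨lam i, hmem i⟩ : L)) (rootSupport w)).card ≤ 3)) :
    InMSTV lam w := by
  have heq : Finset.univ.filter (fun i : Fin s =>
      (∃ j, w ⟨i, j⟩ ≠ 0) ∧
      ∀ i' : Fin s, (∃ j', w ⟨i', j'⟩ ≠ 0) →
        v ⟨lam i', hmem i'⟩ ≤ v ⟨lam i, hmem i⟩) =
      dominant v (fun i => (⟨lam i, hmem i⟩ : L)) (rootSupport w) := by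
    ext i
    simp only [mem_dominant, rootSupport, Finset.mem_filter, Finset.mem_univ, true_and]
  refine ⟨hw, L, hmem, hL, v, hv, fun hna => ?_, fun hna => ?_⟩
  · rw [heq]
    exact h.resolve_right fun h' => h'.1 hna
  · rw [heq]
    exact h.elim (fun h' => by omega) fun h' => h'.2

instance : Algebra.IsAlgebraic ℚ Qbar := by
  rw [Subsingleton.elim (DivisionRing.toRatAlgebra : Algebra ℚ Qbar)
    (AlgebraicClosure.instAlgebra ℚ)]
  exact AlgebraicClosure.isAlgebraic ℚ

instance : IsAlgClosure ℚ Qbar := ⟨inferInstance, inferInstance⟩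

instance : Normal ℚ Qbar := IsAlgClosure.normal ℚ Qbar

lemma exists_galois_intermediateField {s : ℕ} (lam : Fin s → Qbar) :
    ∃ L : IntermediateField ℚ Qbar, FiniteDimensional ℚ L ∧ IsGalois ℚ L ∧ ∀ i, lam i ∈ L := by
  let K : IntermediateField ℚ Qbar := IntermediateField.adjoin ℚ (Set.range lam)
  have : FiniteDimensional ℚ K :=
    IntermediateField.finiteDimensional_adjoin fun a _ =>
      (Algebra.IsAlgebraic.isAlgebraic (R := ℚ) a).isIntegral
  have hnormal := normalClosure.normal ℚ K Qbar
  rw [Subsingleton.elim (IntermediateField.algebra' _) DivisionRing.toRatAlgebra] at hnormal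
  refine ⟨IntermediateField.normalClosure ℚ K Qbar, inferInstance, ⟨⟩, fun i => ?_⟩
  exact K.le_normalClosure (IntermediateField.subset_adjoin _ _ ⟨i, rfl⟩)

lemma exists_sum_smul_apply_eq_zero {T : Type*} (c : Fin 2 → T → Qbar) (t : T) :
    ∃ β : Fin 2 → Qbar, β ≠ 0 ∧ (∑ p, β p • c p) t = 0 := by
  by_cases h : c 0 t = 0
  · exact ⟨![1, 0], fun h0 => one_ne_zero (congrFun h0 0), by simp [h]⟩
  · refine ⟨![c 1 t, -c 0 t], fun h0 => h (neg_eq_zero.1 (congrFun h0 1)), ?_⟩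
    simp [Fin.sum_univ_two]
    ring

lemma ExpPolyInstance.sum_smul_ne_zero {d k : ℕ} (I : ExpPolyInstance d k) {β : Fin k → Qbar}
    (hβ : β ≠ 0) : ∑ p, β p • I.coeff p ≠ 0 := fun h =>
  hβ (funext (Fintype.linearIndependent_iff.1 I.indep β h))

/-- The coefficient of a simple root can be eliminated from two sequences. -/
lemma ExpPolyInstance.exists_rootSupport_subset_erase {d : ℕ} (I : ExpPolyInstance d 2)
    {i : Fin I.s} (hi : I.m i = 1) :
    ∃ β : Fin 2 → Qbar, β ≠ 0 ∧
      rootSupport (∑ p, β p • I.coeff p) ⊆ Finset.univ.erase i := by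
  obtain ⟨β, hβ, h⟩ := exists_sum_smul_apply_eq_zero I.coeff ⟨i, ⟨0, by omega⟩⟩
  refine ⟨β, hβ, fun l hl => Finset.mem_erase.2 ⟨?_, Finset.mem_univ _⟩⟩
  rintro rfl
  obtain ⟨j, hj⟩ := (Finset.mem_filter.1 hl).2
  refine hj ?_
  rwa [show j = ⟨0, by omega⟩ from Fin.ext (by have := j.2; omega)]

end Reduction

/-- `SimSkolem(6,2)` is MSTV-reducible. -/
theorem mstv_reducible_six_two :
    ∀ I : ExpPolyInstance 6 2, MSTVReducible I := by
  intro I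
  obtain ⟨L, hfin, hgal, hmem⟩ := exists_galois_intermediateField I.lam
  have : NumberField L := ⟨⟩
  set x : Fin I.s → L := fun i => ⟨I.lam i, hmem i⟩ with hxdef
  have hx : ∀ i, x i ≠ 0 := fun i h => I.lam_ne_zero i (congrArg Subtype.val h)
  have hnd : ∀ i j, i ≠ j → ∀ n : ℕ, 1 ≤ n → (x i / x j) ^ n ≠ 1 := fun i j hij n hn h =>
    I.nondeg i j hij n hn (congrArg Subtype.val h)
  by_cases hsmall : ∃ β : Fin 2 → Qbar, β ≠ 0 ∧
      (rootSupport (∑ p, β p • I.coeff p)).card ≤ 4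
  · obtain ⟨β, hβ, hcard⟩ := hsmall
    obtain ⟨v, hv, h⟩ := exists_absoluteValue_card_dominant_le hx hnd
      (S := rootSupport (∑ p, β p • I.coeff p)) (k := 2) (r := 0) (by omega) (by omega)
    rw [hxdef] at h
    exact ⟨β, hβ, inMSTV_of_card_dominant_le (I.sum_smul_ne_zero hβ) hmem hv
      (h.imp_right fun h' => ⟨h'.1, by omega⟩)⟩
  push Not at hsmall
  have hlarge : ∀ i, I.m i = 1 → 6 ≤ I.s := by
    intro i hi
    obtain ⟨β, hβ, hsub⟩ := I.exists_rootSupport_subset_erase hi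
    have h1 := hsmall β hβ
    have h2 := Finset.card_le_card hsub
    rw [Finset.card_erase_of_mem (Finset.mem_univ i), Finset.card_univ, Fintype.card_fin] at h2
    omega
  have hs5 : 5 ≤ I.s := by
    have h1 := (hsmall 1 one_ne_zero).trans_le (Finset.card_le_univ _)
    rwa [Fintype.card_fin] at h1
  have hsum_le : ∀ b, (∀ i, b ≤ I.m i) → I.s * b ≤ 6 := fun b hb => by
    have h := Finset.card_nsmul_le_sum Finset.univ I.m b fun i _ => hb i
    rw [Finset.card_univ, Fintype.card_fin, smul_eq_mul] at h
    exact h.trans I.order_le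
  have hs : I.s = 6 := by
    have h1 := hsum_le 1 I.m_pos
    obtain ⟨i, hi⟩ : ∃ i, I.m i = 1 := by
      by_contra! hcon
      have h2 := hsum_le 2 fun i => by
        have := I.m_pos i
        have := hcon i
        omega
      omega
    have := hlarge i hi
    omega
  have hm : ∀ i, I.m i = 1 := by
    intro i
    have h1 := Finset.add_sum_erase Finset.univ I.m (Finset.mem_univ i)
    have h2 := Finset.card_nsmul_le_sum (Finset.univ.erase i) (fun l => I.m l) 1 fun l _ => I.m_pos l
    rw [Finset.card_erase_of_mem (Finset.mem_univ i), Finset.card_univ, Fintype.card_fin,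
      smul_eq_mul] at h2
    have h3 := I.m_pos i
    have h4 := I.order_le
    omega
  have hcard : (Finset.univ : Finset (Fin I.s)).card = 6 := by
    rw [Finset.card_univ, Fintype.card_fin, hs]
  obtain ⟨v, hv, h⟩ := exists_absoluteValue_card_dominant_le hx hnd
    (S := Finset.univ) (k := 3) (r := 1) (by omega) (by omega)
  obtain ⟨i, -, hi⟩ := exists_card_dominant_erase_le v x (S := Finset.univ) (by omega)
  obtain ⟨β, hβ, hsub⟩ := I.exists_rootSupport_subset_erase (hm i)
  have heq : rootSupport (∑ p, β p • I.coeff p) = Finset.univ.erase i := by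
    refine Finset.eq_of_subset_of_card_le hsub ?_
    rw [Finset.card_erase_of_mem (Finset.mem_univ i), hcard]
    exact hsmall β hβ
  refine ⟨β, hβ, inMSTV_of_card_dominant_le (I.sum_smul_ne_zero hβ) hmem hv ?_⟩
  rw [heq]
  rw [hxdef] at h hi
  exact h.imp (fun h' => by omega) fun h' => ⟨h'.1, by omega⟩

end
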